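/- Let 0 < a < b < 1 and s > 0, and suppose Y_0 = ⌊aN⌋. Then (U_{T_{⌊bN⌋}}/N) · 1_{T_{⌊bN⌋} < ∞} converges in probability, as N → ∞, to b · a^{(1+s)/(2s)} (1−a)^{−1/(2s)} [ (1−b)^{1/(2s)} b^{−(1+s)/(2s)} + ∫_a^b (1−x)^{1/(2s)} x^{−(1+s)/(2s)} (1/2 + 1/(2s(1−x))) dx ]. -/

import Mathlib

open MeasureTheory Filter

/-- The biparental Moran model with viability selection on a population of size `N`
with selection parameter `s`, realized on a probability space `Ω`.
`W n` is the matrix of genetic weights, `Y n` the set of advantaged individuals,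
`mo n`, `fa n`, `ka n` the positions of the mother, father and killed individual
at time step `n`. -/
structure MoranModel (N : ℕ) (s : ℝ) (Ω : Type) [MeasurableSpace Ω] where
  P : Measure Ω
  isProb : IsProbabilityMeasure P
  W : ℕ → Ω → Fin N → Fin N → ℝ
  Y : ℕ → Ω → Finset (Fin N)
  mo : ℕ → Ω → Fin N
  fa : ℕ → Ω → Fin N
  ka : ℕ → Ω → Fin N
  meas_W : ∀ n, Measurable (W n)
  meas_Y : ∀ n (A : Set (Finset (Fin N))), MeasurableSet (Y n ⁻¹' A)
  meas_mo : ∀ n, Measurable (mo n)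
  meas_fa : ∀ n, Measurable (fa n)
  meas_ka : ∀ n, Measurable (ka n)
  W_init : ∀ ω i j, W 0 ω i j = if i = j then (1 : ℝ) else 0
  Y_rec : ∀ n ω, Y (n + 1) ω =
    if mo n ω ∈ Y n ω then insert (ka n ω) (Y n ω) else (Y n ω).erase (ka n ω)
  W_rec : ∀ n ω i j, W (n + 1) ω i j =
    if i = ka n ω then (W n ω (mo n ω) j + W n ω (fa n ω) j) / 2 else W n ω i j
  /-- Conditionally on the natural filtration of the chain `(W, Y)`, the mother and
  father are uniform on the population, and independently the killed individual `k` is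
  chosen with probability proportional to `1 + s` if disadvantaged, `1` if advantaged. -/
  law : ∀ (n : ℕ) (A : Set Ω),
    MeasurableSet[⨆ k ∈ Set.Iic n,
      (MeasurableSpace.comap (W k) inferInstance ⊔ MeasurableSpace.comap (Y k) ⊤)] A →
    ∀ i j k : Fin N,
      (P (A ∩ {ω | mo n ω = i ∧ fa n ω = j ∧ ka n ω = k})).toReal =
        (1 / (N : ℝ) ^ 2) *
          ∫ ω in A, (1 + s * (if k ∈ Y n ω then 0 else 1)) /
            (((Y n ω).card : ℝ) + (1 + s) * ((N : ℝ) - ((Y n ω).card : ℝ))) ∂P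

/-- The natural filtration of the chain `(W, Y)`. -/
def MoranModel.F {N : ℕ} {s : ℝ} {Ω : Type} [MeasurableSpace Ω]
    (M : MoranModel N s Ω) (n : ℕ) : MeasurableSpace Ω :=
  ⨆ k ∈ Set.Iic n,
    (MeasurableSpace.comap (M.W k) inferInstance ⊔ MeasurableSpace.comap (M.Y k) ⊤)


/-- `U n`, the total genetic weight of the initially advantaged ancestors among the
advantaged individuals at time `n`. -/
noncomputable def MoranModel.U {N : ℕ} {s : ℝ} {Ω : Type} [MeasurableSpace Ω]
    (M : MoranModel N s Ω) (n : ℕ) (ω : Ω) : ℝ :=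
  ∑ l ∈ M.Y n ω, ∑ l' ∈ M.Y 0 ω, M.W n ω l l'

/-- The hitting time `T_k` of level `k` by the number of advantaged individuals
`(Yₙ)ₙ`, with value `∞` if the level is never hit. -/
noncomputable def MoranModel.T {N : ℕ} {s : ℝ} {Ω : Type} [MeasurableSpace Ω]
    (M : MoranModel N s Ω) (k : ℕ) (ω : Ω) : ℕ∞ :=
  ⨅ (n : ℕ) (_ : (M.Y n ω).card = k), (n : ℕ∞)

/-- `(U_{T_k}/N) 1_{T_k < ∞}`. -/
noncomputable def MoranModel.UatT {N : ℕ} {s : ℝ} {Ω : Type} [MeasurableSpace Ω]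
    (M : MoranModel N s Ω) (k : ℕ) (ω : Ω) : ℝ :=
  if M.T k ω ≠ ⊤ then M.U (M.T k ω).toNat ω / N else 0

/-- The integral `∫_a^y (1−x)^{1/(2s)} x^{−(1+s)/(2s)} (1/2 + 1/(2s(1−x))) dx`. -/
noncomputable def intI (s a y : ℝ) : ℝ :=
  ∫ x in a..y, (1 - x) ^ (1 / (2 * s)) / x ^ ((1 + s) / (2 * s)) *
    (1 / 2 + 1 / (2 * s) * (1 / (1 - x)))


noncomputable def ggf (s y : ℝ) : ℝ := (1 - y) ^ (1 / (2 * s)) / y ^ ((1 + s) / (2 * s))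

lemma ggf_pos (s y : ℝ) (h0 : 0 < y) (h1 : y < 1) : 0 < ggf s y := by
  unfold ggf
  have : 0 < 1 - y := by linarith
  positivity

lemma ggf_deriv (s y : ℝ) (hs : 0 < s) (h0 : 0 < y) (h1 : y < 1) :
    HasDerivAt (ggf s) (-(ggf s y) * ((1 + s - s * y) / (2 * s * y * (1 - y)))) y := by
  have h1' : 0 < 1 - y := by linarith
  have e1 : HasDerivAt (fun x : ℝ => (1 - x) ^ (1 / (2 * s)))
      (-1 * (1 / (2 * s)) * (1 - y) ^ (1 / (2 * s) - 1)) y := by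
    have : HasDerivAt (fun x : ℝ => 1 - x) (-1) y := by
      simpa using (hasDerivAt_id y).const_sub 1
    exact this.rpow_const (Or.inl h1'.ne')
  have e2 : HasDerivAt (fun x : ℝ => x ^ ((1 + s) / (2 * s)))
      (1 * ((1 + s) / (2 * s)) * y ^ ((1 + s) / (2 * s) - 1)) y :=
    (hasDerivAt_id y).rpow_const (Or.inl h0.ne')
  have hp : 0 < y ^ ((1 + s) / (2 * s)) := by positivity
  have e3 := e1.div e2 hp.ne'
  refine e3.congr_deriv ?_
  unfold ggf
  rw [Real.rpow_sub_one h1'.ne', Real.rpow_sub_one h0.ne']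
  have hq : 0 < (1 - y) ^ (1 / (2 * s)) := by positivity
  generalize (1 - y) ^ (1 / (2 * s)) = Q at *
  generalize y ^ ((1 + s) / (2 * s)) = R at *
  field_simp
  ring

lemma intI_deriv (s a y : ℝ) (hs : 0 < s) (ha : 0 < a) (ha1 : a < 1) (h0 : 0 < y) (h1 : y < 1) :
    HasDerivAt (intI s a) (ggf s y * (1 / 2 + 1 / (2 * s) * (1 / (1 - y)))) y := by
  have hc : ContinuousOn (fun x : ℝ => (1 - x) ^ (1 / (2 * s)) / x ^ ((1 + s) / (2 * s)) *
    (1 / 2 + 1 / (2 * s) * (1 / (1 - x)))) (Set.Ioo 0 1) := by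
    intro x hx
    have hx0 := hx.1
    have hx1 : 0 < 1 - x := by linarith [hx.2]
    have hd := (ggf_deriv s x hs hx.1 hx.2).continuousAt
    apply ContinuousAt.continuousWithinAt
    refine ContinuousAt.mul hd ?_
    have : (1 - x) ≠ 0 := hx1.ne'
    fun_prop (disch := assumption)
  unfold intI
  refine intervalIntegral.integral_hasDerivAt_right ?_ ?_ ?_
  · refine ContinuousOn.intervalIntegrable (hc.mono ?_)
    exact (Set.ordConnected_Ioo).uIcc_subset ⟨ha, ha1⟩ ⟨h0, h1⟩
  · exact hc.stronglyMeasurableAtFilter isOpen_Ioo y ⟨h0, h1⟩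
  · exact hc.continuousAt (isOpen_Ioo.mem_nhds ⟨h0, h1⟩)

noncomputable def JJ (s a y : ℝ) : ℝ := ggf s y + intI s a y

noncomputable def KK (s a b y : ℝ) : ℝ := (JJ s a b - JJ s a y) / ggf s y

lemma KK_deriv (s a b y : ℝ) (hs : 0 < s) (ha : 0 < a) (ha1 : a < 1) (h0 : 0 < y) (h1 : y < 1) :
    HasDerivAt (KK s a b) ((1 + s - s * y) / (2 * s * y) +
      KK s a b y * ((1 + s - s * y) / (2 * s * y * (1 - y)))) y := by
  have g0 := ggf_pos s y h0 h1
  have h1' : 0 < 1 - y := by linarith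
  have e1 := ggf_deriv s y hs h0 h1
  have e2 := (e1.add (intI_deriv s a y hs ha ha1 h0 h1)).const_sub (JJ s a b)
  have e3 := e2.div e1 g0.ne'
  refine e3.congr_deriv ?_
  simp only [KK, JJ, Pi.add_apply]
  generalize ggf s y = g at *
  generalize intI s a y = q at *
  field_simp
  ring

lemma KK_b (s a b : ℝ) : KK s a b b = 0 := by simp [KK]

lemma KK_a (s a b : ℝ) (ha : 0 < a) (hb : a < 1) :
    b * (1 + KK s a b a) = b * (a ^ ((1 + s) / (2 * s)) / (1 - a) ^ (1 / (2 * s))) *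
                ((1 - b) ^ (1 / (2 * s)) / b ^ ((1 + s) / (2 * s)) + intI s a b) := by
  have h1' : 0 < 1 - a := by linarith
  have : intI s a a = 0 := by simp [intI]
  have g0 := ggf_pos s a ha hb
  have e : 1 + KK s a b a = JJ s a b / ggf s a := by
    simp only [KK, JJ, this]; field_simp; ring
  rw [e]
  simp only [JJ, ggf]
  have p1 : 0 < (1 - a) ^ (1 / (2 * s)) := by positivity
  have p2 : 0 < a ^ ((1 + s) / (2 * s)) := by positivity
  field_simp

lemma KK_contDiff (s a b : ℝ) (hs : 0 < s) (ha : 0 < a) (ha1 : a < 1) :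
    ContDiffOn ℝ 1 (KK s a b) (Set.Ioo 0 1) := by
  have hd : ∀ y ∈ Set.Ioo (0:ℝ) 1, _ := fun y hy => KK_deriv s a b y hs ha ha1 hy.1 hy.2
  have hc : ContinuousOn (KK s a b) (Set.Ioo 0 1) :=
    fun y hy => (hd y hy).continuousAt.continuousWithinAt
  rw [show (1 : WithTop ℕ∞) = 0 + 1 by simp, contDiffOn_succ_iff_deriv_of_isOpen isOpen_Ioo]
  refine ⟨fun y hy => (hd y hy).differentiableAt.differentiableWithinAt, by simp, ?_⟩
  rw [contDiffOn_zero]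
  refine ContinuousOn.congr (f := fun y => (1 + s - s * y) / (2 * s * y) +
      KK s a b y * ((1 + s - s * y) / (2 * s * y * (1 - y)))) ?_ (fun y hy => (hd y hy).deriv)
  have n1 : ∀ y ∈ Set.Ioo (0:ℝ) 1, 2 * s * y ≠ 0 := fun y hy => by
    have := hy.1; positivity
  have n2 : ∀ y ∈ Set.Ioo (0:ℝ) 1, 2 * s * y * (1 - y) ≠ 0 := fun y hy => by
    have := hy.1; have : 0 < 1 - y := by linarith [hy.2]
    positivity
  fun_prop (disch := assumption)

/-- second order regularity on an interval -/
def NiceOn (C : ℝ) (f f' : ℝ → ℝ) (I : Set ℝ) : Prop :=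
  (∀ y ∈ I, |f y| ≤ C) ∧ (∀ y ∈ I, |f' y| ≤ C) ∧
  (∀ y ∈ I, ∀ z ∈ I, |f z - f y| ≤ C * |z - y|) ∧
  (∀ y ∈ I, ∀ z ∈ I, |f z - f y - (z - y) * f' y| ≤ C * (z - y) ^ 2)

lemma NiceOn.mono {C C' : ℝ} {f f' : ℝ → ℝ} {I : Set ℝ} (h : NiceOn C f f' I) (hC : C ≤ C') :
    NiceOn C' f f' I := by
  obtain ⟨h1, h2, h3, h4⟩ := h
  refine ⟨fun y hy => (h1 y hy).trans hC, fun y hy => (h2 y hy).trans hC,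
    fun y hy z hz => (h3 y hy z hz).trans ?_, fun y hy z hz => (h4 y hy z hz).trans ?_⟩
  · gcongr
  · gcongr

lemma exists_nice (f f' : ℝ → ℝ) (lo hi : ℝ)
    (hd : ∀ y ∈ Set.Icc lo hi, HasDerivAt f (f' y) y) (hc : ContDiffOn ℝ 1 f' (Set.Icc lo hi)) :
    ∃ C, NiceOn C f f' (Set.Icc lo hi) := by
  have hcf : ContinuousOn f (Set.Icc lo hi) :=
    fun y hy => (hd y hy).continuousAt.continuousWithinAt
  obtain ⟨C1, hC1⟩ := isCompact_Icc.exists_bound_of_continuousOn hcf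
  obtain ⟨C2, hC2⟩ := isCompact_Icc.exists_bound_of_continuousOn hc.continuousOn
  obtain ⟨C3, hC3⟩ := hc.exists_lipschitzOnWith one_ne_zero (convex_Icc lo hi) isCompact_Icc
  refine ⟨max C1 (max C2 C3), fun y hy => (hC1 y hy).trans (by simp),
    fun y hy => (hC2 y hy).trans (by simp), fun y hy z hz => ?_, fun y hy z hz => ?_⟩
  · have := (convex_Icc lo hi).norm_image_sub_le_of_norm_hasDerivWithin_le
      (fun x hx => (hd x hx).hasDerivWithinAt) hC2 hy hz
    simp only [Real.norm_eq_abs] at this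
    refine this.trans ?_
    gcongr; simp
  · have hsub : Set.uIcc y z ⊆ Set.Icc lo hi := Set.ordConnected_Icc.uIcc_subset hy hz
    have := (convex_uIcc y z).norm_image_sub_le_of_norm_hasDerivWithin_le
      (f := fun x => f x - x * f' y) (f' := fun x => f' x - 1 * f' y) (C := C3 * |z - y|)
      (fun x hx => ((hd x (hsub hx)).sub ((hasDerivAt_id x).mul_const _)).hasDerivWithinAt)
      (fun x hx => by
        have h := hC3.dist_le_mul x (hsub hx) y hy
        rw [Real.dist_eq, Real.dist_eq] at h
        rw [one_mul, Real.norm_eq_abs]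
        refine h.trans ?_
        exact mul_le_mul_of_nonneg_left (Set.abs_sub_left_of_mem_uIcc hx) C3.2)
      Set.left_mem_uIcc Set.right_mem_uIcc
    simp only [Real.norm_eq_abs] at this
    calc _ = |f z - z * f' y - (f y - y * f' y)| := by congr 1; ring
      _ ≤ _ := this
      _ = C3 * (z - y) ^ 2 := by rw [mul_assoc, ← abs_mul, abs_mul_self, sq]
      _ ≤ _ := by gcongr; simp

noncomputable def KKd (s a b y : ℝ) : ℝ := (1 + s - s * y) / (2 * s * y) +
      KK s a b y * ((1 + s - s * y) / (2 * s * y * (1 - y)))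
noncomputable def alf (s a b y : ℝ) : ℝ := (1 + KK s a b y) / y
noncomputable def alfd (s a b y : ℝ) : ℝ := (KKd s a b y * y - (1 + KK s a b y) * 1) / y ^ 2
noncomputable def bet (s a b y : ℝ) : ℝ := (- KK s a b y) / (1 - y)
noncomputable def betd (s a b y : ℝ) : ℝ :=
  ((- KKd s a b y) * (1 - y) - (- KK s a b y) * (-1)) / (1 - y) ^ 2
noncomputable def LL (s y : ℝ) : ℝ := (1 + s) / s * Real.log y - 1 / s * Real.log (1 - y)
noncomputable def LLd (s y : ℝ) : ℝ := (1 + s) / s * (1 / y) - 1 / s * (-1 / (1 - y))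

/-- `u α(y) + v β(y) + γ(y) - κ t` is conserved by the limiting ODE -/
def Cons (s : ℝ) (al al' be be' ga' : ℝ → ℝ) (κ : ℝ) : Prop :=
  ∀ y, 0 < y → y < 1 →
    (al y * (-1 / (1 + s - s * y) + (1 + y) / 2) + be y * ((1 - y) / 2)
      + al' y * (s * y * (1 - y) / (1 + s - s * y)) = 0) ∧
    (al y * (y / 2) + be y * (-(1 + s) / (1 + s - s * y) + (1 + (1 - y)) / 2)
      + be' y * (s * y * (1 - y) / (1 + s - s * y)) = 0) ∧
    ga' y * (s * y * (1 - y) / (1 + s - s * y)) = κ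

lemma cons1 (s a b : ℝ) (hs : 0 < s) :
    Cons s (alf s a b) (alfd s a b) (bet s a b) (betd s a b) (fun _ => 0) 0 := by
  intro y h0 h1
  have h1' : 0 < 1 - y := by linarith
  have hd : 0 < 1 + s - s * y := by nlinarith
  refine ⟨?_, ?_, by ring⟩
  · simp only [alf, alfd, bet, KKd]
    generalize KK s a b y = K
    obtain ⟨d, hd'⟩ : ∃ d, d = 1 + s - s * y := ⟨_, rfl⟩
    rw [← hd'] at hd ⊢
    field_simp
    rw [hd']
    ring
  · simp only [alf, betd, bet, KKd]
    generalize KK s a b y = K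
    obtain ⟨d, hd'⟩ : ∃ d, d = 1 + s - s * y := ⟨_, rfl⟩
    rw [← hd'] at hd ⊢
    field_simp
    rw [hd']
    ring

lemma cons2 (s : ℝ) (hs : 0 < s) :
    Cons s (fun _ => 0) (fun _ => 0) (fun _ => 0) (fun _ => 0) (LLd s) 1 := by
  intro y h0 h1
  have h1' : 0 < 1 - y := by linarith
  have hd : 0 < 1 + s - s * y := by nlinarith
  refine ⟨by ring, by ring, ?_⟩
  simp only [LLd]
  field_simp
  ring

lemma alf_deriv (s a b y : ℝ) (hs : 0 < s) (ha : 0 < a) (ha1 : a < 1) (h0 : 0 < y) (h1 : y < 1) :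
    HasDerivAt (alf s a b) (alfd s a b y) y :=
  ((KK_deriv s a b y hs ha ha1 h0 h1).const_add 1).div (hasDerivAt_id y) h0.ne'

lemma bet_deriv (s a b y : ℝ) (hs : 0 < s) (ha : 0 < a) (ha1 : a < 1) (h0 : 0 < y) (h1 : y < 1) :
    HasDerivAt (bet s a b) (betd s a b y) y := by
  have : HasDerivAt (fun x : ℝ => 1 - x) (-1) y := by
      simpa using (hasDerivAt_id y).const_sub 1
  exact (KK_deriv s a b y hs ha ha1 h0 h1).neg.div this (by linarith : 0 < 1 - y).ne'

lemma LL_deriv (s y : ℝ) (h0 : 0 < y) (h1 : y < 1) :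
    HasDerivAt (LL s) (LLd s y) y := by
  have : HasDerivAt (fun x : ℝ => 1 - x) (-1) y := by
      simpa using (hasDerivAt_id y).const_sub 1
  exact (((hasDerivAt_id y).log h0.ne').const_mul _).sub
    ((this.log (by linarith : 0 < 1 - y).ne').const_mul _)

lemma nice_zero (I : Set ℝ) : NiceOn 0 (fun _ => 0) (fun _ => 0) I := by
  refine ⟨?_, ?_, ?_, ?_⟩ <;> simp

lemma all_nice (s a b lo hi : ℝ) (hs : 0 < s) (ha : 0 < a) (ha1 : a < 1) (hlo : 0 < lo)
    (hhi : hi < 1) : ∃ C, 0 < C ∧ NiceOn C (alf s a b) (alfd s a b) (Set.Icc lo hi) ∧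
      NiceOn C (bet s a b) (betd s a b) (Set.Icc lo hi) ∧
      NiceOn C (LL s) (LLd s) (Set.Icc lo hi) ∧
      NiceOn C (fun _ => 0) (fun _ => 0) (Set.Icc lo hi) := by
  have hsub : ∀ y ∈ Set.Icc lo hi, 0 < y ∧ y < 1 := fun y hy =>
    ⟨lt_of_lt_of_le hlo hy.1, lt_of_le_of_lt hy.2 hhi⟩
  have hK : ContDiffOn ℝ 1 (KK s a b) (Set.Icc lo hi) :=
    (KK_contDiff s a b hs ha ha1).mono (fun y hy => hsub y hy)
  have n0 : ∀ y ∈ Set.Icc lo hi, y ≠ 0 := fun y hy => (hsub y hy).1.ne'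
  have n3 : ∀ y ∈ Set.Icc lo hi, 1 - y ≠ 0 := fun y hy => by
    have := (hsub y hy).2
    intro h; linarith
  have n1 : ∀ y ∈ Set.Icc lo hi, 2 * s * y ≠ 0 := fun y hy =>
    mul_ne_zero (by positivity) (n0 y hy)
  have n2 : ∀ y ∈ Set.Icc lo hi, 2 * s * y * (1 - y) ≠ 0 := fun y hy =>
    mul_ne_zero (n1 y hy) (n3 y hy)
  have n4 : ∀ y ∈ Set.Icc lo hi, y ^ 2 ≠ 0 := fun y hy => pow_ne_zero 2 (n0 y hy)
  have n5 : ∀ y ∈ Set.Icc lo hi, (1 - y) ^ 2 ≠ 0 := fun y hy => pow_ne_zero 2 (n3 y hy)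
  have hKd : ContDiffOn ℝ 1 (KKd s a b) (Set.Icc lo hi) := by
    unfold KKd
    fun_prop (disch := assumption)
  have hal : ContDiffOn ℝ 1 (alfd s a b) (Set.Icc lo hi) := by
    unfold alfd
    fun_prop (disch := assumption)
  have hbe : ContDiffOn ℝ 1 (betd s a b) (Set.Icc lo hi) := by
    unfold betd
    fun_prop (disch := assumption)
  have hL : ContDiffOn ℝ 1 (LLd s) (Set.Icc lo hi) := by
    unfold LLd
    fun_prop (disch := assumption)
  obtain ⟨C1, h1⟩ := exists_nice _ _ lo hi
    (fun y hy => alf_deriv s a b y hs ha ha1 (hsub y hy).1 (hsub y hy).2) hal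
  obtain ⟨C2, h2⟩ := exists_nice _ _ lo hi
    (fun y hy => bet_deriv s a b y hs ha ha1 (hsub y hy).1 (hsub y hy).2) hbe
  obtain ⟨C3, h3⟩ := exists_nice _ _ lo hi
    (fun y hy => LL_deriv s y (hsub y hy).1 (hsub y hy).2) hL
  refine ⟨max 1 (max C1 (max C2 C3)), by positivity, h1.mono (by simp), h2.mono (by simp),
    h3.mono (by simp), (nice_zero _).mono (by positivity)⟩

lemma LL_lt (s x y : ℝ) (hs : 0 < s) (hx : 0 < x) (hxy : x < y) (hy : y < 1) :
    LL s x < LL s y := by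
  have h1 := Real.log_lt_log hx hxy
  have h2 := Real.log_lt_log (by linarith : 0 < 1 - y) (by linarith : 1 - y < 1 - x)
  have h3 : 0 < (1 + s) / s := by positivity
  have h4 : 0 < 1 / s := by positivity
  unfold LL
  nlinarith

noncomputable def chi {N : ℕ} (Y : Finset (Fin N)) (i : Fin N) : ℝ := if i ∈ Y then 1 else 0

noncomputable def rk {N : ℕ} (s : ℝ) (Y : Finset (Fin N)) (k : Fin N) : ℝ :=
  (1 + s * (if k ∈ Y then 0 else 1)) / ((Y.card : ℝ) + (1 + s) * ((N : ℝ) - (Y.card : ℝ)))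

noncomputable def Ex {N : ℕ} (s : ℝ) (Y : Finset (Fin N)) (φ : Fin N → Fin N → Fin N → ℝ) : ℝ :=
  ∑ i, ∑ j, ∑ k, φ i j k * (1 / (N : ℝ) ^ 2 * rk s Y k)

section
variable {N : ℕ} (s : ℝ) (Y : Finset (Fin N))

lemma chi_cases (i : Fin N) : chi Y i = 0 ∨ chi Y i = 1 := by
  unfold chi; split_ifs <;> simp

lemma sum_chi : ∑ i, chi Y i = Y.card := by simp [chi]

lemma sum_chi_mul (w : Fin N → ℝ) : ∑ i, chi Y i * w i = ∑ i ∈ Y, w i := by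
  simp [chi, ← Finset.sum_filter]

lemma sum_chi_mul' (w : Fin N → ℝ) : ∑ i, (1 - chi Y i) * w i = ∑ i ∈ Yᶜ, w i := by
  have h1 := sum_chi_mul Y w
  have h2 := Finset.sum_add_sum_compl Y w
  simp only [sub_mul, one_mul, Finset.sum_sub_distrib]
  linarith

lemma card_le_real : (Y.card : ℝ) ≤ N := by
  have := Finset.card_le_univ Y
  rw [Fintype.card_fin] at this
  exact_mod_cast this

lemma den_pos (hs : 0 < s) (hN : 0 < N) :
    0 < ((Y.card : ℝ) + (1 + s) * ((N : ℝ) - (Y.card : ℝ))) := by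
  have h := card_le_real Y
  have : (0:ℝ) < N := by exact_mod_cast hN
  nlinarith

lemma rk_eq (k : Fin N) : rk s Y k = (1 + s * (1 - chi Y k)) /
    ((Y.card : ℝ) + (1 + s) * ((N : ℝ) - (Y.card : ℝ))) := by
  unfold rk chi; split_ifs <;> simp

lemma rk_nonneg (hs : 0 < s) (hN : 0 < N) (k : Fin N) : 0 ≤ rk s Y k := by
  have := den_pos s Y hs hN
  unfold rk; split_ifs <;> positivity

lemma sum_rk (hs : 0 < s) (hN : 0 < N) : ∑ k, rk s Y k = 1 := by
  have := den_pos s Y hs hN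
  simp only [rk_eq]
  rw [← Finset.sum_div, div_eq_one_iff_eq this.ne', Finset.sum_add_distrib, ← Finset.mul_sum,
    Finset.sum_sub_distrib, sum_chi]
  simp
  ring

variable {s Y}

lemma Ex_k (hN : 0 < N) (B : Fin N → ℝ) : Ex s Y (fun _ _ k => B k) = ∑ k, B k * rk s Y k := by
  have : (N:ℝ) ≠ 0 := by exact_mod_cast hN.ne'
  simp only [Ex, Finset.sum_const, Finset.card_univ, Fintype.card_fin, nsmul_eq_mul,
    Finset.mul_sum]
  refine Finset.sum_congr rfl fun k _ => ?_
  field_simp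

lemma Ex_ij (hs : 0 < s) (hN : 0 < N) (X : Fin N → Fin N → ℝ) :
    Ex s Y (fun i j _ => X i j) = 1 / (N:ℝ) ^ 2 * ∑ i, ∑ j, X i j := by
  simp only [Ex, Finset.mul_sum]
  refine Finset.sum_congr rfl fun i _ => Finset.sum_congr rfl fun j _ => ?_
  rw [← Finset.mul_sum, ← Finset.mul_sum, sum_rk s Y hs hN]
  ring

lemma Ex_add (f g : Fin N → Fin N → Fin N → ℝ) :
    Ex s Y (fun i j k => f i j k + g i j k) = Ex s Y f + Ex s Y g := by
  simp only [Ex, add_mul, Finset.sum_add_distrib]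

lemma Ex_mul (c : ℝ) (f : Fin N → Fin N → Fin N → ℝ) :
    Ex s Y (fun i j k => c * f i j k) = c * Ex s Y f := by
  simp only [Ex, mul_assoc, Finset.mul_sum]

lemma Ex_const (hs : 0 < s) (hN : 0 < N) (c : ℝ) : Ex s Y (fun _ _ _ => c) = c := by
  rw [Ex_k hN, ← Finset.mul_sum, sum_rk s Y hs hN, mul_one]

lemma Ex_mono (hs : 0 < s) (hN : 0 < N) {f g : Fin N → Fin N → Fin N → ℝ}
    (h : ∀ i j k, f i j k ≤ g i j k) : Ex s Y f ≤ Ex s Y g := by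
  unfold Ex
  gcongr with i _ j _ k _
  · have := rk_nonneg s Y hs hN k
    positivity
  · exact h i j k

lemma Ex_abs (hs : 0 < s) (hN : 0 < N) {f : Fin N → Fin N → Fin N → ℝ} {c : ℝ}
    (h : ∀ i j k, |f i j k| ≤ c) : |Ex s Y f| ≤ c := by
  rw [abs_le]
  constructor
  · rw [← Ex_const (Y := Y) hs hN (-c)]
    exact Ex_mono hs hN fun i j k => (abs_le.1 (h i j k)).1
  · rw [← Ex_const (Y := Y) hs hN c]
    exact Ex_mono hs hN fun i j k => (abs_le.1 (h i j k)).2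

lemma Ex_dY (hs : 0 < s) (hN : 0 < N) :
    Ex s Y (fun i _ k => chi Y i - chi Y k) = (Y.card : ℝ) / N -
      (Y.card : ℝ) / ((Y.card : ℝ) + (1 + s) * ((N : ℝ) - (Y.card : ℝ))) := by
  have hN' : (N:ℝ) ≠ 0 := by exact_mod_cast hN.ne'
  have e := Ex_add (s := s) (Y := Y) (fun i _ _ => chi Y i) (fun _ _ k => - chi Y k)
  simp only [← sub_eq_add_neg] at e
  rw [e, Ex_ij hs hN, Ex_k hN]
  have : ∀ k, -chi Y k * rk s Y k =
     - (chi Y k / ((Y.card : ℝ) + (1 + s) * ((N : ℝ) - (Y.card : ℝ)))) := fun k => by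
    rw [rk_eq]
    rcases chi_cases Y k with h | h <;> rw [h] <;> ring
  simp only [this, Finset.sum_neg_distrib, ← Finset.sum_div, sum_chi]
  simp only [Finset.sum_const, Finset.card_univ, Fintype.card_fin, nsmul_eq_mul, ← Finset.mul_sum,
    sum_chi]
  field_simp
  ring

lemma sum_ij (X w : Fin N → ℝ) :
    ∑ i, ∑ j, X i * ((w i + w j) / 2) =
      (N * (∑ i, X i * w i) + (∑ i, X i) * ∑ j, w j) / 2 := by
  have : ∀ i j, X i * ((w i + w j) / 2) = (X i * w i + X i * w j) / 2 := fun i j => by ring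
  simp only [this, ← Finset.sum_div, Finset.sum_add_distrib, Finset.sum_const, Finset.card_univ,
    Fintype.card_fin, nsmul_eq_mul, ← Finset.mul_sum, Finset.sum_mul]

lemma Ex_dU (hs : 0 < s) (hN : 0 < N) (w : Fin N → ℝ) :
    Ex s Y (fun i j k => chi Y i * ((w i + w j) / 2) - chi Y k * w k) =
      (N * (∑ i, chi Y i * w i) + Y.card * ∑ i, w i) / (2 * N ^ 2) -
      (∑ i, chi Y i * w i) / ((Y.card : ℝ) + (1 + s) * ((N : ℝ) - (Y.card : ℝ))) := by
  have hN' : (N:ℝ) ≠ 0 := by exact_mod_cast hN.ne'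
  have e := Ex_add (s := s) (Y := Y) (fun i j _ => chi Y i * ((w i + w j) / 2))
    (fun _ _ k => - (chi Y k * w k))
  simp only [← sub_eq_add_neg] at e
  rw [e, Ex_ij hs hN, Ex_k hN, sum_ij, sum_chi]
  have : ∀ k, -(chi Y k * w k) * rk s Y k =
     - (chi Y k * w k / ((Y.card : ℝ) + (1 + s) * ((N : ℝ) - (Y.card : ℝ)))) := fun k => by
    rw [rk_eq]
    rcases chi_cases Y k with h | h <;> rw [h] <;> ring
  simp only [this, Finset.sum_neg_distrib, ← Finset.sum_div]
  field_simp
  ring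

lemma Ex_dV (hs : 0 < s) (hN : 0 < N) (w : Fin N → ℝ) :
    Ex s Y (fun i j k => (1 - chi Y i) * ((w i + w j) / 2) - (1 - chi Y k) * w k) =
      (N * (∑ i, (1 - chi Y i) * w i) + (N - Y.card) * ∑ i, w i) / (2 * N ^ 2) -
      (1 + s) * (∑ i, (1 - chi Y i) * w i) /
        ((Y.card : ℝ) + (1 + s) * ((N : ℝ) - (Y.card : ℝ))) := by
  have hN' : (N:ℝ) ≠ 0 := by exact_mod_cast hN.ne'
  have e := Ex_add (s := s) (Y := Y) (fun i j _ => (1 - chi Y i) * ((w i + w j) / 2))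
    (fun _ _ k => - ((1 - chi Y k) * w k))
  simp only [← sub_eq_add_neg] at e
  have e2 : ∑ i, (1 - chi Y i) = N - Y.card := by
    rw [Finset.sum_sub_distrib, sum_chi]; simp
  rw [e, Ex_ij hs hN, Ex_k hN, sum_ij _ w, e2]
  have : ∀ k, -((1 - chi Y k) * w k) * rk s Y k =
     - ((1 + s) * ((1 - chi Y k) * w k) / ((Y.card : ℝ) + (1 + s) * ((N : ℝ) - (Y.card : ℝ)))) :=
    fun k => by
    rw [rk_eq]
    rcases chi_cases Y k with h | h <;> rw [h] <;> ring
  simp only [this, Finset.sum_neg_distrib, ← Finset.sum_div, ← Finset.mul_sum]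
  field_simp
  ring

end

def newY {N : ℕ} (Y : Finset (Fin N)) (i k : Fin N) : Finset (Fin N) :=
  if i ∈ Y then insert k Y else Y.erase k

noncomputable def newW {N : ℕ} (w : Fin N → ℝ) (i j k : Fin N) (l : Fin N) : ℝ :=
  if l = k then (w i + w j) / 2 else w l

lemma chi_new {N : ℕ} (Y : Finset (Fin N)) (i k l : Fin N) :
    chi (newY Y i k) l = if l = k then chi Y i else chi Y l := by
  unfold chi newY
  by_cases h : i ∈ Y <;> by_cases h2 : l = k <;> simp [h, h2]

lemma sum_change {N : ℕ} (p q : Fin N → ℝ) (k : Fin N) (h : ∀ l, l ≠ k → p l = q l) :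
    ∑ l, p l = ∑ l, q l + (p k - q k) := by
  have : ∑ l, (p l - q l) = p k - q k :=
    Finset.sum_eq_single k (fun l _ hl => by rw [h l hl, sub_self]) (by simp)
  rw [Finset.sum_sub_distrib] at this
  linarith

lemma card_new {N : ℕ} (Y : Finset (Fin N)) (i k : Fin N) :
    ((newY Y i k).card : ℝ) = Y.card + (chi Y i - chi Y k) := by
  rw [← sum_chi, ← sum_chi, sum_change _ (chi Y) k (fun l hl => by simp [chi_new, hl])]
  simp [chi_new]

lemma U_new {N : ℕ} (Y : Finset (Fin N)) (w : Fin N → ℝ) (i j k : Fin N) :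
    ∑ l, chi (newY Y i k) l * newW w i j k l = ∑ l, chi Y l * w l +
      (chi Y i * ((w i + w j) / 2) - chi Y k * w k) := by
  rw [sum_change _ (fun l => chi Y l * w l) k (fun l hl => by simp [chi_new, newW, hl])]
  simp [chi_new, newW]

lemma V_new {N : ℕ} (Y : Finset (Fin N)) (w : Fin N → ℝ) (i j k : Fin N) :
    ∑ l, (1 - chi (newY Y i k) l) * newW w i j k l = ∑ l, (1 - chi Y l) * w l +
      ((1 - chi Y i) * ((w i + w j) / 2) - (1 - chi Y k) * w k) := by
  rw [sum_change _ (fun l => (1 - chi Y l) * w l) k (fun l hl => by simp [chi_new, newW, hl])]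
  simp [chi_new, newW]

/-- the test function -/
noncomputable def ff (al be ga : ℝ → ℝ) (κ : ℝ) {N : ℕ} (n : ℕ) (w : Fin N → ℝ)
    (Y : Finset (Fin N)) : ℝ :=
  (∑ l, chi Y l * w l) / N * al (Y.card / N) + (∑ l, (1 - chi Y l) * w l) / N * be (Y.card / N)
    + ga (Y.card / N) - κ * n / N

lemma prod_rem {f f' : ℝ → ℝ} {C : ℝ} {I : Set ℝ} (h : NiceOn C f f' I) {u du y z e : ℝ}
    (hu : |u| ≤ 1) (hdu : |du| ≤ e) (hy : y ∈ I) (hz : z ∈ I) (hyz : |z - y| ≤ e) :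
    |(u + du) * f z - u * f y - (du * f y + u * ((z - y) * f' y))| ≤ 2 * C * e ^ 2 ∧
    |(u + du) * f z - u * f y| ≤ 2 * C * e := by
  obtain ⟨h1, h2, h3, h4⟩ := h
  have hC : 0 ≤ C := (abs_nonneg _).trans (h1 y hy)
  have he : 0 ≤ e := (abs_nonneg _).trans hdu
  constructor
  · have e1 : (u + du) * f z - u * f y - (du * f y + u * ((z - y) * f' y)) =
      du * (f z - f y) + u * (f z - f y - (z - y) * f' y) := by ring
    rw [e1]
    refine (abs_add_le _ _).trans ?_
    rw [abs_mul, abs_mul]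
    have a1 : |du| * |f z - f y| ≤ e * (C * e) := by
      gcongr
      exact (h3 y hy z hz).trans (by gcongr)
    have a2 : |u| * |f z - f y - (z - y) * f' y| ≤ 1 * (C * e ^ 2) := by
      gcongr
      refine (h4 y hy z hz).trans ?_
      rw [← sq_abs (z - y)]
      gcongr
    linarith
  · have e1 : (u + du) * f z - u * f y =
      du * f z + u * (f z - f y) := by ring
    rw [e1]
    refine (abs_add_le _ _).trans ?_
    rw [abs_mul, abs_mul]
    have a1 : |du| * |f z| ≤ e * C := by
      gcongr
      exact h1 z hz
    have a2 : |u| * |f z - f y| ≤ 1 * (C * e) := by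
      gcongr
      exact (h3 y hy z hz).trans (by gcongr)
    linarith

lemma sum_weight_bound {N : ℕ} (hN : 0 < N) (c w : Fin N → ℝ) (hc : ∀ l, 0 ≤ c l ∧ c l ≤ 1)
    (hw : ∀ l, 0 ≤ w l ∧ w l ≤ 1) : |(∑ l, c l * w l) / N| ≤ 1 := by
  have hN' : (0:ℝ) < N := by exact_mod_cast hN
  rw [abs_of_nonneg, div_le_one hN']
  · calc ∑ l, c l * w l ≤ ∑ l : Fin N, (1:ℝ) := by
          gcongr with l
          nlinarith [hc l, hw l]
      _ = N := by simp
  · refine div_nonneg (Finset.sum_nonneg fun l _ => mul_nonneg (hc l).1 (hw l).1) hN'.le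

lemma chi_bd {N : ℕ} (Y : Finset (Fin N)) (i : Fin N) : 0 ≤ chi Y i ∧ chi Y i ≤ 1 := by
  rcases chi_cases Y i with h | h <;> rw [h] <;> norm_num

lemma one_step {N : ℕ} (hN : 0 < N) {s : ℝ} (hs : 0 < s) {al al' be be' ga ga' : ℝ → ℝ} {κ C : ℝ}
    {I : Set ℝ} (hal : NiceOn C al al' I) (hbe : NiceOn C be be' I) (hga : NiceOn C ga ga' I)
    (hcons : Cons s al al' be be' ga' κ) (n : ℕ) (w : Fin N → ℝ) (Y : Finset (Fin N))
    (hw : ∀ l, 0 ≤ w l ∧ w l ≤ 1) (hY : (Y.card : ℝ) / N ∈ I)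
    (hY0 : 0 < (Y.card : ℝ) / N) (hY1 : (Y.card : ℝ) / N < 1)
    (hY' : ∀ i k, ((newY Y i k).card : ℝ) / N ∈ I) :
    (∀ i j k, |ff al be ga κ (n + 1) (newW w i j k) (newY Y i k) - ff al be ga κ n w Y|
        ≤ (6 * C + |κ|) / N) ∧
    |Ex s Y (fun i j k => ff al be ga κ (n + 1) (newW w i j k) (newY Y i k)
        - ff al be ga κ n w Y)| ≤ (6 * C + |κ|) / (N : ℝ) ^ 2 := by
  have hN' : (0:ℝ) < N := by exact_mod_cast hN
  set y : ℝ := (Y.card : ℝ) / N with hy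
  set U : ℝ := ∑ l, chi Y l * w l with hU
  set V : ℝ := ∑ l, (1 - chi Y l) * w l with hV
  have hUb : |U / N| ≤ 1 := sum_weight_bound hN _ w (chi_bd Y) hw
  have hVb : |V / N| ≤ 1 := sum_weight_bound hN _ w
    (fun l => ⟨by linarith [(chi_bd Y l).2], by linarith [(chi_bd Y l).1]⟩) hw
  set dY : Fin N → Fin N → Fin N → ℝ := fun i _ k => chi Y i - chi Y k with hdY
  set dU : Fin N → Fin N → Fin N → ℝ :=
    fun i j k => chi Y i * ((w i + w j) / 2) - chi Y k * w k with hdU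
  set dV : Fin N → Fin N → Fin N → ℝ :=
    fun i j k => (1 - chi Y i) * ((w i + w j) / 2) - (1 - chi Y k) * w k with hdV
  have bY : ∀ i j k, |dY i j k / N| ≤ 1 / N := fun i j k => by
    rw [abs_div, abs_of_pos hN']
    gcongr
    simp only [hdY]
    rw [abs_le]
    constructor <;> linarith [chi_bd Y i, chi_bd Y k]
  have bU : ∀ i j k, |dU i j k / N| ≤ 1 / N := fun i j k => by
    rw [abs_div, abs_of_pos hN']
    gcongr
    simp only [hdU]
    rw [abs_le]
    rcases chi_cases Y i with h | h <;> rcases chi_cases Y k with h' | h' <;> rw [h, h'] <;>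
    constructor <;> linarith [hw i, hw j, hw k]
  have bV : ∀ i j k, |dV i j k / N| ≤ 1 / N := fun i j k => by
    rw [abs_div, abs_of_pos hN']
    gcongr
    simp only [hdV]
    rw [abs_le]
    rcases chi_cases Y i with h | h <;> rcases chi_cases Y k with h' | h' <;> rw [h, h'] <;>
    constructor <;> linarith [hw i, hw j, hw k]
  have hz : ∀ i j k, ((newY Y i k).card : ℝ) / N - y = dY i j k / N := fun i j k => by
    rw [card_new, hy]; simp only [hdY]; ring
  have eqf : ∀ i j k, ff al be ga κ (n + 1) (newW w i j k) (newY Y i k) - ff al be ga κ n w Y =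
      ((U / N + dU i j k / N) * al (((newY Y i k).card : ℝ) / N) - U / N * al y) +
      ((V / N + dV i j k / N) * be (((newY Y i k).card : ℝ) / N) - V / N * be y) +
      ((1 + 0) * ga (((newY Y i k).card : ℝ) / N) - 1 * ga y) - κ / N := fun i j k => by
    unfold ff
    rw [U_new, V_new]
    push_cast
    ring
  have r1 := fun i j k => prod_rem hal hUb (bU i j k) hY (hY' i k)
    ((hz i j k).symm ▸ bY i j k)
  have r2 := fun i j k => prod_rem hbe hVb (bV i j k) hY (hY' i k)
    ((hz i j k).symm ▸ bY i j k)
  have r3 := fun i j k => prod_rem hga (u := 1) (du := 0) (by simp) (e := 1 / N)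
    (by simp) hY (hY' i k) ((hz i j k).symm ▸ bY i j k)
  constructor
  · intro i j k
    rw [eqf]
    have hk : |κ / N| = |κ| / N := by rw [abs_div, abs_of_pos hN']
    have a1 := (r1 i j k).2
    have a2 := (r2 i j k).2
    have a3 := (r3 i j k).2
    have : (6 * C + |κ|) / N = 2 * C * (1 / N) + 2 * C * (1 / N) + 2 * C * (1 / N) + |κ| / N := by
      ring
    rw [this, ← hk]
    refine (abs_sub _ _).trans ?_
    gcongr
    refine (abs_add_le _ _).trans ?_
    gcongr
    refine (abs_add_le _ _).trans ?_
    gcongr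
  · set lin : Fin N → Fin N → Fin N → ℝ := fun i j k =>
      (al y / N) * dU i j k + ((be y / N) * dV i j k +
        (((U / N * al' y + V / N * be' y + ga' y) / N) * dY i j k + (- κ / N))) with hlin
    have eR : ∀ i j k, |(ff al be ga κ (n + 1) (newW w i j k) (newY Y i k) - ff al be ga κ n w Y) +
        (-1) * lin i j k| ≤ (6 * C + |κ|) / (N : ℝ) ^ 2 := fun i j k => by
      rw [eqf]
      have a1 := (r1 i j k).1
      have a2 := (r2 i j k).1
      have a3 := (r3 i j k).1
      rw [hz i j k] at a1 a2 a3
      have hk : 0 ≤ |κ| / (N : ℝ) ^ 2 := by positivity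
      have : (6 * C + |κ|) / (N : ℝ) ^ 2 = 2 * C * (1 / N) ^ 2 + 2 * C * (1 / N) ^ 2
        + 2 * C * (1 / N) ^ 2 + |κ| / (N : ℝ) ^ 2 := by
        ring
      rw [this]
      refine le_trans ?_ (le_add_of_nonneg_right hk)
      refine le_trans (le_of_eq ?_) ((abs_add_three _ _ _).trans (add_le_add_three a1 a2 a3))
      congr 1
      simp only [hlin]
      ring
    have hl0 : Ex s Y lin = 0 := by
      simp only [hlin]
      rw [Ex_add, Ex_mul, Ex_add, Ex_mul, Ex_add, Ex_mul, Ex_const hs hN, Ex_dU hs hN,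
        Ex_dV hs hN, Ex_dY hs hN, ← hU, ← hV]
      have hS : ∑ i, w i = U + V := by
        rw [hU, hV, ← Finset.sum_add_distrib]
        exact Finset.sum_congr rfl fun i _ => by ring
      obtain ⟨c1, c2, c3⟩ := hcons y hY0 hY1
      have hd : 0 < 1 + s - s * y := by nlinarith
      have hcard : (Y.card : ℝ) = N * y := by rw [hy]; field_simp
      have hD : (N * y : ℝ) + (1 + s) * ((N : ℝ) - N * y) = N * (1 + s - s * y) := by ring
      rw [hS, hcard, hD]
      generalize al y = A at *
      generalize be y = B at *
      generalize al' y = A' at *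
      generalize be' y = B' at *
      generalize ga' y = G' at *
      have hUU : U = N * (U / N) := by field_simp
      have hVV : V = N * (V / N) := by field_simp
      generalize U / N = u at *
      generalize V / N = v at *
      rw [hUU, hVV]
      have : ∀ x : ℝ, N * x = 0 → x = 0 := fun x hx => by
        rcases mul_eq_zero.1 hx with h | h
        · exact absurd h hN'.ne'
        · exact h
      apply this
      have goal2 : u * (A * (-1 / (1 + s - s * y) + (1 + y) / 2) + B * ((1 - y) / 2)
        + A' * (s * y * (1 - y) / (1 + s - s * y))) + v * (A * (y / 2) +
        B * (-(1 + s) / (1 + s - s * y) + (1 + (1 - y)) / 2)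
        + B' * (s * y * (1 - y) / (1 + s - s * y))) +
         (G' * (s * y * (1 - y) / (1 + s - s * y)) - κ) = 0 := by rw [c1, c2, c3]; ring
      rw [← goal2]
      obtain ⟨d, hd'⟩ : ∃ d, d = 1 + s - s * y := ⟨_, rfl⟩
      rw [← hd'] at hd ⊢
      field_simp
      rw [hd']
      ring
    have e := Ex_add (s := s) (Y := Y) (fun i j k =>
      ff al be ga κ (n + 1) (newW w i j k) (newY Y i k) - ff al be ga κ n w Y)
      (fun i j k => (-1) * lin i j k)
    rw [Ex_mul, hl0, mul_zero, add_zero] at e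
    rw [← e]
    exact Ex_abs hs hN eR

section
variable {N : ℕ} {s : ℝ} {Ω : Type} [mΩ : MeasurableSpace Ω] (M : MoranModel N s Ω)

lemma F_le (n : ℕ) : M.F n ≤ mΩ := by
  unfold MoranModel.F
  refine iSup₂_le fun k _ => sup_le (M.meas_W k).comap_le ?_
  rintro _ ⟨A, -, rfl⟩
  exact M.meas_Y k A

lemma F_mono {n m : ℕ} (h : n ≤ m) : M.F n ≤ M.F m := by
  unfold MoranModel.F
  refine iSup₂_le fun k hk => ?_
  exact le_iSup₂_of_le k (le_trans (Set.mem_Iic.1 hk) h) le_rfl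

lemma F_Y {β : Type*} [MeasurableSpace β] {k n : ℕ} (hk : k ≤ n) (g : Finset (Fin N) → β) :
    Measurable[M.F n] (fun ω => g (M.Y k ω)) := by
  intro A _
  have h : MeasurableSpace.comap (M.Y k) ⊤ ≤ M.F n :=
    le_iSup₂_of_le (f := fun k (_ : k ∈ Set.Iic n) => (MeasurableSpace.comap (M.W k) inferInstance
      ⊔ MeasurableSpace.comap (M.Y k) ⊤)) k (Set.mem_Iic.2 hk) le_sup_right
  exact h _ ⟨g ⁻¹' A, trivial, rfl⟩

lemma F_W {k n : ℕ} (hk : k ≤ n) (i j : Fin N) :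
    Measurable[M.F n] (fun ω => M.W k ω i j) := by
  have h : MeasurableSpace.comap (M.W k) inferInstance ≤ M.F n :=
    le_iSup₂_of_le (f := fun k (_ : k ∈ Set.Iic n) => (MeasurableSpace.comap (M.W k) inferInstance
      ⊔ MeasurableSpace.comap (M.Y k) ⊤)) k (Set.mem_Iic.2 hk) le_sup_left
  have h2 : Measurable[M.F n] (M.W k) := fun A hA => h _ ⟨A, hA, rfl⟩
  exact (measurable_pi_apply j).comp ((measurable_pi_apply i).comp h2)

/-- weight of the initially advantaged -/
noncomputable def ww (n : ℕ) (ω : Ω) (l : Fin N) : ℝ := ∑ l' ∈ M.Y 0 ω, M.W n ω l l'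

lemma F_ww {k n : ℕ} (hk : k ≤ n) (l : Fin N) : Measurable[M.F n] (fun ω => ww M k ω l) := by
  have : (fun ω => ww M k ω l) = fun ω => ∑ l', chi (M.Y 0 ω) l' * M.W k ω l l' := by
    funext ω
    rw [sum_chi_mul]; rfl
  rw [this]
  refine Finset.measurable_sum _ fun l' _ => ?_
  exact (F_Y M (Nat.zero_le n) (fun Y => chi Y l')).mul (F_W M hk l l')

lemma ww_succ (n : ℕ) (ω : Ω) :
    ww M (n + 1) ω = newW (ww M n ω) (M.mo n ω) (M.fa n ω) (M.ka n ω) := by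
  funext l
  unfold ww newW
  simp only [M.W_rec]
  split_ifs with h
  · rw [← Finset.sum_div, Finset.sum_add_distrib]
  · rfl

lemma Y_succ (n : ℕ) (ω : Ω) : M.Y (n + 1) ω = newY (M.Y n ω) (M.mo n ω) (M.ka n ω) :=
  M.Y_rec n ω

lemma ww_zero (ω : Ω) (l : Fin N) : ww M 0 ω l = chi (M.Y 0 ω) l := by
  simp [ww, M.W_init, chi]

lemma ww_bd (n : ℕ) (ω : Ω) : ∀ l, 0 ≤ ww M n ω l ∧ ww M n ω l ≤ 1 := by
  induction n with
  | zero => intro l; rw [ww_zero]; exact chi_bd _ l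
  | succ n ih =>
    intro l
    rw [ww_succ]
    unfold newW
    split_ifs
    · constructor <;> linarith [ih (M.mo n ω), ih (M.fa n ω)]
    · exact ih l

lemma law_int (hs : 0 < s) (hN : 0 < N) (n : ℕ) (i j k : Fin N) (φ : Ω → ℝ)
    (hφ : Measurable[M.F n] φ) :
    ∫ ω in {ω | M.mo n ω = i ∧ M.fa n ω = j ∧ M.ka n ω = k}, φ ω ∂M.P =
      ∫ ω, φ ω * (1 / (N : ℝ) ^ 2 * rk s (M.Y n ω) k) ∂M.P := by
  have := M.isProb
  have hE : MeasurableSet {ω | M.mo n ω = i ∧ M.fa n ω = j ∧ M.ka n ω = k} :=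
    ((M.meas_mo n) (measurableSet_singleton i)).inter
      (((M.meas_fa n) (measurableSet_singleton j)).inter
      ((M.meas_ka n) (measurableSet_singleton k)))
  set E := {ω | M.mo n ω = i ∧ M.fa n ω = j ∧ M.ka n ω = k}
  set ρ : Ω → ℝ := fun ω => 1 / (N : ℝ) ^ 2 * rk s (M.Y n ω) k with hρ
  have hρm' : Measurable[M.F n] ρ := F_Y M le_rfl (fun Y => 1 / (N : ℝ) ^ 2 * rk s Y k)
  have hρm : Measurable ρ := hρm'.mono (F_le M n) le_rfl
  have hρ0 : ∀ ω, 0 ≤ ρ ω := fun ω => by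
    have := rk_nonneg s (M.Y n ω) hs hN k
    simp only [hρ]; positivity
  have hρi : Integrable ρ M.P := by
    refine Integrable.of_bound hρm.aestronglyMeasurable (1 / (N : ℝ) ^ 2 * 1)
      (Eventually.of_forall fun ω => ?_)
    rw [Real.norm_eq_abs, abs_of_nonneg (hρ0 ω)]
    simp only [hρ]
    gcongr
    rw [← sum_rk s (M.Y n ω) hs hN]
    exact Finset.single_le_sum (f := rk s (M.Y n ω)) (fun l _ => rk_nonneg s _ hs hN l)
      (Finset.mem_univ k)
  have key : (M.P.restrict E).trim (F_le M n) =
      (M.P.withDensity (fun ω => ENNReal.ofReal (ρ ω))).trim (F_le M n) := by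
    refine @Measure.ext _ (M.F n) _ _ fun A hA => ?_
    have hA' : MeasurableSet A := F_le M n A hA
    rw [trim_measurableSet_eq _ hA, trim_measurableSet_eq _ hA, Measure.restrict_apply hA',
      withDensity_apply _ hA', ← ofReal_integral_eq_lintegral_ofReal hρi.integrableOn
        (Eventually.of_forall hρ0), ← ENNReal.ofReal_toReal (measure_ne_top M.P (A ∩ E))]
    congr 1
    have := M.law n A hA i j k
    rw [this, ← integral_const_mul]
    rfl
  have hφm := hφ.mono (F_le M n) le_rfl
  have hsm : StronglyMeasurable[M.F n] φ := hφ.stronglyMeasurable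
  calc ∫ ω in E, φ ω ∂M.P = ∫ ω, φ ω ∂((M.P.restrict E).trim (F_le M n)) :=
        integral_trim (F_le M n) hsm
    _ = ∫ ω, φ ω ∂(M.P.withDensity (fun ω => ENNReal.ofReal (ρ ω))) := by
        rw [key]; exact (integral_trim (F_le M n) hsm).symm
    _ = _ := by
        rw [integral_withDensity_eq_integral_toReal_smul hρm.ennreal_ofReal
          (Eventually.of_forall fun ω => ENNReal.ofReal_lt_top)]
        refine integral_congr_ae (Eventually.of_forall fun ω => ?_)
        simp only [smul_eq_mul, ENNReal.toReal_ofReal (hρ0 ω)]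
        ring

lemma step_int (hs : 0 < s) (hN : 0 < N) (n : ℕ) (Ψ : Fin N → Fin N → Fin N → Ω → ℝ)
    (hΨ : ∀ i j k, Measurable[M.F n] (Ψ i j k)) (B : ℝ) (hB : ∀ i j k ω, |Ψ i j k ω| ≤ B) :
    ∫ ω, Ψ (M.mo n ω) (M.fa n ω) (M.ka n ω) ω ∂M.P =
      ∫ ω, Ex s (M.Y n ω) (fun i j k => Ψ i j k ω) ∂M.P := by
  have := M.isProb
  have hm : ∀ i j k, Measurable (Ψ i j k) := fun i j k => (hΨ i j k).mono (F_le M n) le_rfl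
  have hint : ∀ i j k, Integrable (Ψ i j k) M.P := fun i j k =>
    Integrable.of_bound (hm i j k).aestronglyMeasurable B (Eventually.of_forall (hB i j k))
  have hE : ∀ i j k, MeasurableSet {ω | M.mo n ω = i ∧ M.fa n ω = j ∧ M.ka n ω = k} :=
    fun i j k => ((M.meas_mo n) (measurableSet_singleton i)).inter
      (((M.meas_fa n) (measurableSet_singleton j)).inter
      ((M.meas_ka n) (measurableSet_singleton k)))
  have e1 : ∀ ω, Ψ (M.mo n ω) (M.fa n ω) (M.ka n ω) ω = ∑ i, ∑ j, ∑ k,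
      Set.indicator {ω | M.mo n ω = i ∧ M.fa n ω = j ∧ M.ka n ω = k} (Ψ i j k) ω := by
    intro ω
    rw [Finset.sum_eq_single (M.mo n ω), Finset.sum_eq_single (M.fa n ω),
      Finset.sum_eq_single (M.ka n ω)]
    · simp
    · intro k _ hk
      simp [Set.indicator, hk.symm]
    · simp
    · intro k _ hk
      simp [Set.indicator, hk.symm]
    · simp
    · intro k _ hk
      simp [Set.indicator, hk.symm]
    · simp
  have hrm : ∀ k, Measurable (fun ω => 1 / (N : ℝ) ^ 2 * rk s (M.Y n ω) k) := fun k =>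
    (F_Y M (k := n) le_rfl (fun Y => 1 / (N : ℝ) ^ 2 * rk s Y k)).mono (F_le M n) le_rfl
  have hint2 : ∀ i j k, Integrable (fun ω => Ψ i j k ω * (1 / (N : ℝ) ^ 2 * rk s (M.Y n ω) k))
      M.P := fun i j k => by
    refine Integrable.of_bound ((hm i j k).mul (hrm k)).aestronglyMeasurable
      (B * (1 / (N : ℝ) ^ 2 * 1)) (Eventually.of_forall fun ω => ?_)
    have h0 := rk_nonneg s (M.Y n ω) hs hN k
    have hB0 : 0 ≤ B := (abs_nonneg _).trans (hB i j k ω)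
    rw [Real.norm_eq_abs, abs_mul, abs_of_nonneg (a := 1 / (N : ℝ) ^ 2 * _) (by positivity)]
    gcongr
    · exact hB i j k ω
    rw [← sum_rk s (M.Y n ω) hs hN]
    exact Finset.single_le_sum (f := rk s (M.Y n ω)) (fun l _ => rk_nonneg s _ hs hN l)
      (Finset.mem_univ k)
  simp only [e1, Ex]
  rw [integral_finsetSum, integral_finsetSum]
  · refine Finset.sum_congr rfl fun i _ => ?_
    rw [integral_finsetSum, integral_finsetSum]
    · refine Finset.sum_congr rfl fun j _ => ?_
      rw [integral_finsetSum, integral_finsetSum]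
      · refine Finset.sum_congr rfl fun k _ => ?_
        rw [integral_indicator (hE i j k)]
        exact law_int M hs hN n i j k _ (hΨ i j k)
      · exact fun k _ => hint2 i j k
      · exact fun k _ => (hint i j k).indicator (hE i j k)
    · exact fun j _ => integrable_finsetSum _ fun k _ => hint2 i j k
    · exact fun j _ => integrable_finsetSum _ fun k _ => (hint i j k).indicator (hE i j k)
  · exact fun i _ => integrable_finsetSum _ fun j _ => integrable_finsetSum _ fun k _ =>
      hint2 i j k
  · exact fun i _ => integrable_finsetSum _ fun j _ => integrable_finsetSum _ fun k _ =>
      (hint i j k).indicator (hE i j k)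

/-- L² estimate for a process with small drift and small increments. -/
lemma L2_bound (hs : 0 < s) (hN : 0 < N) (G : ℕ → Ω → ℝ)
    (δ : ℕ → Fin N → Fin N → Fin N → Ω → ℝ) (c : ℝ)
    (hG : ∀ n, Measurable[M.F n] (G n)) (hδ : ∀ n i j k, Measurable[M.F n] (δ n i j k))
    (hG0 : ∀ ω, G 0 ω = 0)
    (hGs : ∀ n ω, G (n + 1) ω = G n ω + δ n (M.mo n ω) (M.fa n ω) (M.ka n ω) ω)
    (hδb : ∀ n i j k ω, |δ n i j k ω| ≤ c / N)
    (hEx : ∀ n ω, |Ex s (M.Y n ω) (fun i j k => δ n i j k ω)| ≤ c / (N : ℝ) ^ 2)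
    (m : ℕ) : ∀ n ≤ m, Integrable (fun ω => G n ω ^ 2) M.P ∧
      ∫ ω, G n ω ^ 2 ∂M.P ≤ n * (2 * (m * (c / N)) * (c / (N : ℝ) ^ 2) + (c / N) ^ 2) := by
  have := M.isProb
  have hGb : ∀ n ω, |G n ω| ≤ n * (c / N) := by
    intro n ω
    induction n with
    | zero => simp [hG0]
    | succ n ih =>
      rw [hGs]
      refine (abs_add_le _ _).trans ?_
      push_cast
      linarith [hδb n (M.mo n ω) (M.fa n ω) (M.ka n ω) ω]
  have hint : ∀ n, Integrable (fun ω => G n ω ^ 2) M.P := fun n => by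
    refine Integrable.of_bound (((hG n).mono (F_le M n) le_rfl).pow_const 2).aestronglyMeasurable
      ((n * (c / N)) ^ 2) (Eventually.of_forall fun ω => ?_)
    rw [Real.norm_eq_abs, abs_pow]
    gcongr
    exact hGb n ω
  intro n
  induction n with
  | zero => intro _; exact ⟨hint 0, by simp [hG0]⟩
  | succ n ih =>
    intro hn
    refine ⟨hint _, ?_⟩
    have ih' := (ih (by omega)).2
    have e1 : ∫ ω, G (n + 1) ω ^ 2 ∂M.P =
        ∫ ω, Ex s (M.Y n ω) (fun i j k => (G n ω + δ n i j k ω) ^ 2) ∂M.P := by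
      simp only [hGs]
      refine step_int M hs hN n (fun i j k ω => (G n ω + δ n i j k ω) ^ 2)
        (fun i j k => ((hG n).add (hδ n i j k)).pow_const 2) ((n * (c / N) + c / N) ^ 2) ?_
      intro i j k ω
      rw [abs_pow]
      gcongr
      refine (abs_add_le _ _).trans ?_
      linarith [hGb n ω, hδb n i j k ω]
    rw [e1]
    set q : ℝ := 2 * (m * (c / N)) * (c / (N : ℝ) ^ 2) + (c / N) ^ 2 with hq
    have pt : ∀ ω, Ex s (M.Y n ω) (fun i j k => (G n ω + δ n i j k ω) ^ 2) ≤ G n ω ^ 2 + q := by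
      intro ω
      have e2 : (fun i j k => (G n ω + δ n i j k ω) ^ 2) = fun i j k => G n ω ^ 2 +
        ((2 * G n ω) * δ n i j k ω + δ n i j k ω ^ 2) := by
        funext i j k; ring
      rw [e2, Ex_add, Ex_add, Ex_const hs hN, Ex_mul]
      have a1 : |Ex s (M.Y n ω) (fun i j k => δ n i j k ω ^ 2)| ≤ (c / N) ^ 2 :=
        Ex_abs hs hN fun i j k => by
          rw [abs_pow]; gcongr; exact hδb n i j k ω
      have a2 : 2 * G n ω * Ex s (M.Y n ω) (fun i j k => δ n i j k ω) ≤
          2 * (m * (c / N)) * (c / (N : ℝ) ^ 2) := by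
        refine (le_abs_self _).trans ?_
        rw [abs_mul, abs_mul, abs_two]
        have hc : 0 ≤ c / N := (abs_nonneg _).trans
          (hδb n (M.mo n ω) (M.fa n ω) (M.ka n ω) ω)
        have : |G n ω| ≤ m * (c / N) := (hGb n ω).trans (by
          gcongr
          omega)
        gcongr
        exact hEx n ω
      linarith [le_abs_self (Ex s (M.Y n ω) (fun i j k => δ n i j k ω ^ 2))]
    calc _ ≤ ∫ ω, (G n ω ^ 2 + q) ∂M.P :=
          integral_mono_of_nonneg (Eventually.of_forall fun ω => by
            have := Ex_mono (s := s) (Y := M.Y n ω) hs hN (f := fun _ _ _ => 0)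
              (g := fun i j k => (G n ω + δ n i j k ω) ^ 2) (fun i j k => by positivity)
            rw [Ex_const hs hN] at this
            exact this) ((hint n).add (integrable_const q)) (Eventually.of_forall pt)
      _ = ∫ ω, G n ω ^ 2 ∂M.P + q := by
          rw [integral_add (hint n) (integrable_const q)]; simp
      _ ≤ _ := by push_cast; linarith

end

section
variable {N : ℕ} {s : ℝ} {Ω : Type} [mΩ : MeasurableSpace Ω] (M : MoranModel N s Ω)

open Classical in
/-- the stopped process -/
noncomputable def GG (al be ga : ℝ → ℝ) (κ : ℝ) (R : ℕ → Prop) : ℕ → Ω → ℝ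
  | 0, _ => 0
  | n + 1, ω => GG al be ga κ R n ω + if (∀ k ≤ n, R (M.Y k ω).card) then
      ff al be ga κ (n + 1) (ww M (n + 1) ω) (M.Y (n + 1) ω) -
        ff al be ga κ n (ww M n ω) (M.Y n ω) else 0

variable (al be ga : ℝ → ℝ) (κ : ℝ) (R : ℕ → Prop)

lemma F_ff {n : ℕ} (t : ℕ) (w : Ω → Fin N → ℝ) (hw : ∀ l, Measurable[M.F n] (fun ω => w ω l))
    (g : Finset (Fin N) → Finset (Fin N)) :
    Measurable[M.F n] (fun ω => ff al be ga κ t (w ω) (g (M.Y n ω))) := by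
  unfold ff
  have h1 : Measurable[M.F n] (fun ω => ∑ l, chi (g (M.Y n ω)) l * w ω l) :=
    Finset.measurable_sum _ fun l _ => (F_Y M le_rfl (fun Y => chi (g Y) l)).mul (hw l)
  have h2 : Measurable[M.F n] (fun ω => ∑ l, (1 - chi (g (M.Y n ω)) l) * w ω l) :=
    Finset.measurable_sum _ fun l _ => (F_Y M le_rfl (fun Y => 1 - chi (g Y) l)).mul (hw l)
  have h3 := F_Y M (le_refl n) (fun Y => al ((g Y).card / N))
  have h4 := F_Y M (le_refl n) (fun Y => be ((g Y).card / N))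
  have h5 := F_Y M (le_refl n) (fun Y => ga ((g Y).card / N))
  exact ((((h1.div_const _).mul h3).add ((h2.div_const _).mul h4)).add h5).sub_const _

lemma F_D (n : ℕ) : MeasurableSet[M.F n] {ω | ∀ k ≤ n, R (M.Y k ω).card} := by
  have : {ω | ∀ k ≤ n, R (M.Y k ω).card} =
      ⋂ k ∈ Set.Iic n, {ω | R (M.Y k ω).card} := by ext; simp
  rw [this]
  refine MeasurableSet.biInter (Set.to_countable _) fun k hk => ?_
  exact F_Y M (β := Prop) (Set.mem_Iic.1 hk) (fun Y => R Y.card) (measurableSet_singleton True) |>.congr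
    (by ext; simp)

lemma F_GG (n : ℕ) : Measurable[M.F n] (GG M al be ga κ R n) := by
  induction n with
  | zero => exact measurable_const
  | succ n ih =>
    refine Measurable.add (ih.mono (F_mono M (Nat.le_succ n)) le_rfl) ?_
    refine Measurable.ite (F_mono M (Nat.le_succ n) _ (F_D M R n)) ?_ measurable_const
    refine Measurable.sub ?_ ?_
    · exact F_ff M al be ga κ (n + 1) (ww M (n + 1)) (fun l => F_ww M le_rfl l) (fun Y => Y)
    · exact (F_ff M al be ga κ n (ww M n) (fun l => F_ww M le_rfl l) (fun Y => Y)).mono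
        (F_mono M (Nat.le_succ n)) le_rfl

lemma GG_run (n : ℕ) (ω : Ω) (h : ∀ k < n, R (M.Y k ω).card) :
    GG M al be ga κ R n ω = ff al be ga κ n (ww M n ω) (M.Y n ω) -
      ff al be ga κ 0 (ww M 0 ω) (M.Y 0 ω) := by
  induction n with
  | zero => simp [GG]
  | succ n ih =>
    rw [GG, if_pos (fun k hk => h k (by omega)), ih (fun k hk => h k (by omega))]
    ring

lemma GG_stop (τ n : ℕ) (hn : τ ≤ n) (ω : Ω) (h : ¬ R (M.Y τ ω).card) :
    GG M al be ga κ R n ω = GG M al be ga κ R τ ω := by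
  induction n, hn using Nat.le_induction with
  | base => rfl
  | succ n hn ih => rw [GG, if_neg (fun h' => h (h' τ hn)), ih, add_zero]

open Classical in
lemma GG_cheb (hs : 0 < s) (hN : 0 < N) {al be ga : ℝ → ℝ} {al' be' ga' : ℝ → ℝ} {C : ℝ} {κ : ℝ}
    {I : Set ℝ}
    (hC : 0 ≤ C) (hal : NiceOn C al al' I) (hbe : NiceOn C be be' I) (hga : NiceOn C ga ga' I)
    (hcons : Cons s al al' be be' ga' κ) 
    (hR : ∀ Y : Finset (Fin N), R Y.card → (Y.card : ℝ) / N ∈ I ∧ 0 < (Y.card : ℝ) / N ∧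
      (Y.card : ℝ) / N < 1 ∧ ∀ i k, ((newY Y i k).card : ℝ) / N ∈ I) (c₀ : ℕ) (ε : ℝ)
    (hε : 0 < ε) :
    M.P {ω | ε ≤ |GG M al be ga κ R (c₀ * N) ω|} ≤
      ENNReal.ofReal (c₀ * (2 * c₀ + 1) * (6 * C + |κ|) ^ 2 / ε ^ 2 / N) := by
  have := M.isProb
  have hN' : (0:ℝ) < N := by exact_mod_cast hN
  obtain ⟨h1, h2⟩ := L2_bound M hs hN (GG M al be ga κ R)
    (fun n i j k ω => if (∀ k ≤ n, R (M.Y k ω).card) then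
      ff al be ga κ (n + 1) (newW (ww M n ω) i j k) (newY (M.Y n ω) i k) -
        ff al be ga κ n (ww M n ω) (M.Y n ω) else 0) (6 * C + |κ|)
    (F_GG M al be ga κ R) (by
      intro n i j k
      refine Measurable.ite (F_D M R n) ?_ measurable_const
      refine Measurable.sub ?_ ?_
      · refine F_ff M al be ga κ (n + 1) (fun ω => newW (ww M n ω) i j k) (fun l => ?_)
          (fun Y => newY Y i k)
        unfold newW
        split_ifs
        · exact ((F_ww M le_rfl i).add (F_ww M le_rfl j)).div_const 2
        · exact F_ww M le_rfl l
      · exact F_ff M al be ga κ n (ww M n) (fun l => F_ww M le_rfl l) (fun Y => Y))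
    (fun ω => rfl) (by
      intro n ω
      rw [GG, ww_succ, Y_succ])
    (by
      intro n i j k ω
      split_ifs with h
      · obtain ⟨a1, a2, a3, a4⟩ := hR _ (h n le_rfl)
        exact (one_step hN hs hal hbe hga hcons n _ _ (ww_bd M n ω) a1 a2 a3 a4).1 i j k
      · rw [abs_zero]; positivity)
    (by
      intro n ω
      by_cases h : (∀ k ≤ n, R (M.Y k ω).card)
      · simp only [if_pos h]
        obtain ⟨a1, a2, a3, a4⟩ := hR _ (h n le_rfl)
        exact (one_step hN hs hal hbe hga hcons n _ _ (ww_bd M n ω) a1 a2 a3 a4).2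
      · simp only [if_neg h]
        rw [Ex_const hs hN, abs_zero]; positivity)
    (c₀ * N) (c₀ * N) le_rfl
  have h3 := mul_meas_ge_le_integral_of_nonneg
    (μ := M.P) (f := fun ω => GG M al be ga κ R (c₀ * N) ω ^ 2)
    (Eventually.of_forall fun ω => sq_nonneg _) h1 (ε ^ 2)
  have hset : {ω | ε ≤ |GG M al be ga κ R (c₀ * N) ω|} =
      {ω | ε ^ 2 ≤ GG M al be ga κ R (c₀ * N) ω ^ 2} := by
    ext ω
    simp only [Set.mem_ofPred_eq]
    rw [← sq_abs (GG M al be ga κ R (c₀ * N) ω)]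
    exact (sq_le_sq₀ hε.le (abs_nonneg _)).symm
  rw [hset]
  rw [← ofReal_measureReal]
  apply ENNReal.ofReal_le_ofReal
  rw [div_div, le_div_iff₀ (by positivity)]
  have h4 := h3.trans h2
  have h5 : (((c₀ * N : ℕ) : ℝ) * (2 * (((c₀ * N : ℕ) : ℝ) * ((6 * C + |κ|) / N)) *
      ((6 * C + |κ|) / (N : ℝ) ^ 2) + ((6 * C + |κ|) / N) ^ 2)) * N =
      c₀ * (2 * c₀ + 1) * (6 * C + |κ|) ^ 2 := by
    push_cast
    field_simp
  rw [← h5]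
  nlinarith [mul_le_mul_of_nonneg_right h4 hN'.le]

lemma T_eq (kb τ : ℕ) (ω : Ω) (h1 : (M.Y τ ω).card = kb) (h2 : ∀ k < τ, (M.Y k ω).card ≠ kb) :
    M.T kb ω = τ := by
  unfold MoranModel.T
  refine le_antisymm (iInf₂_le τ h1) (le_iInf₂ fun n hn => ?_)
  rw [Nat.cast_le]
  by_contra hlt
  exact h2 n (by omega) hn

lemma U_eq (n : ℕ) (ω : Ω) : M.U n ω = ∑ l, chi (M.Y n ω) l * ww M n ω l := by
  rw [sum_chi_mul]; rfl

def RR (a : ℝ) (N kb : ℕ) (k : ℕ) : Prop := a / 2 * N ≤ k ∧ k < kb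

lemma RR_ok {a b : ℝ} (hN : 0 < N) (ha : 0 < a) (hb : b < 1) (h4 : 4 ≤ a * N) (hb0 : 0 < b)
    (Y : Finset (Fin N)) (h : RR a N ⌊b * N⌋₊ Y.card) :
    (Y.card : ℝ) / N ∈ Set.Icc (a / 4) b ∧ 0 < (Y.card : ℝ) / N ∧
      (Y.card : ℝ) / N < 1 ∧ ∀ i k, ((newY Y i k).card : ℝ) / N ∈ Set.Icc (a / 4) b := by
  have hN' : (0:ℝ) < N := by exact_mod_cast hN
  obtain ⟨h1, h2⟩ := h
  have h3 : (Y.card : ℝ) + 1 ≤ b * N := by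
    have : ((Y.card + 1 : ℕ) : ℝ) ≤ ⌊b * N⌋₊ := by exact_mod_cast h2
    have h5 := Nat.floor_le (by positivity : 0 ≤ b * N)
    push_cast at this
    linarith
  have A : ∀ x : ℝ, Y.card - 1 ≤ x → x ≤ Y.card + 1 → x / N ∈ Set.Icc (a / 4) b := by
    intro x hx hx'
    constructor
    · rw [le_div_iff₀ hN']; linarith
    · rw [div_le_iff₀ hN']; linarith
  have A0 := A Y.card (by linarith) (by linarith)
  refine ⟨A0, ?_, ?_, fun i k => ?_⟩
  · linarith [A0.1]
  · linarith [A0.2]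
  · rw [card_new]
    apply A <;> linarith [chi_bd Y i, chi_bd Y k]

lemma good {a b C ε ε₂ : ℝ} (hN : 0 < N) (hs : 0 < s) (ha : 0 < a) (hab : a < b) (hb : b < 1)
    (h4 : 4 ≤ a * N) (hgap : 1 ≤ (b - a) * N) (ω : Ω) (hY0 : (M.Y 0 ω).card = ⌊a * N⌋₊)
    (hL : ∀ y ∈ Set.Icc (a / 4) b, |LL s y| ≤ C) (c₀ : ℕ) (hc₀ : 2 * C + 1 ≤ c₀)
    (hε1 : ε₂ ≤ 1) (hε2 : ε₂ ≤ LL s (3 * a / 4) - LL s (a / 2))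
    (k1 : |KK s a b ((⌊a * N⌋₊ : ℝ) / N) - KK s a b a| < ε / 4)
    (k2 : |alf s a b ((⌊b * N⌋₊ : ℝ) / N) - 1 / b| < ε / 4)
    (k3 : |bet s a b ((⌊b * N⌋₊ : ℝ) / N)| < ε / 4)
    (g1 : |GG M (alf s a b) (bet s a b) (fun _ => 0) 0 (RR a N ⌊b * N⌋₊) (c₀ * N) ω| < ε / 4)
    (g2 : |GG M (fun _ => 0) (fun _ => 0) (LL s) 1 (RR a N ⌊b * N⌋₊) (c₀ * N) ω| < ε₂) :
    |M.UatT ⌊b * N⌋₊ ω - b * (1 + KK s a b a)| < ε := by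
  have hN' : (0:ℝ) < N := by exact_mod_cast hN
  have hb0 : 0 < b := ha.trans hab
  have f1 := Nat.floor_le (by positivity : 0 ≤ a * N)
  have f2 := Nat.lt_floor_add_one (a * N)
  have R0 : RR a N ⌊b * N⌋₊ (M.Y 0 ω).card := by
    rw [hY0]
    refine ⟨by linarith, ?_⟩
    rw [Nat.lt_iff_add_one_le]
    apply Nat.le_floor
    push_cast
    linarith
  have y0lo : 3 * a / 4 ≤ (⌊a * N⌋₊ : ℝ) / N := by
    rw [le_div_iff₀ hN']; linarith
  have y0hi : (⌊a * N⌋₊ : ℝ) / N ≤ a := by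
    rw [div_le_iff₀ hN']; linarith
  have y0I : (⌊a * N⌋₊ : ℝ) / N ∈ Set.Icc (a / 4) b := ⟨by linarith, by linarith⟩
  have hex : ∃ τ, ¬ RR a N ⌊b * N⌋₊ (M.Y τ ω).card := by
    by_contra hcon
    push Not at hcon
    rw [GG_run _ _ _ _ _ _ _ _ (fun k _ => hcon k)] at g2
    simp only [ff] at g2
    have hm := (RR_ok hN ha hb h4 hb0 _ (hcon (c₀ * N))).1
    have b1 := abs_le.1 (hL _ hm)
    have b2 := abs_le.1 (hL _ y0I)
    have b3 := (abs_lt.1 g2).1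
    rw [hY0] at b3
    have : ((c₀ * N : ℕ) : ℝ) / N = c₀ := by push_cast; field_simp
    simp only [mul_zero, one_mul, this] at b3
    simp only [Nat.cast_zero, zero_div, zero_add, sub_zero] at b3
    linarith
  classical
  set τ := Nat.find hex with hτ
  have hτ1 : ¬ RR a N ⌊b * N⌋₊ (M.Y τ ω).card := Nat.find_spec hex
  have hτ2 : ∀ k < τ, RR a N ⌊b * N⌋₊ (M.Y k ω).card := fun k hk => by
    by_contra h; exact Nat.find_min hex hk h
  have hτm : τ ≤ c₀ * N := by
    by_contra hcon
    push Not at hcon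
    rw [GG_run _ _ _ _ _ _ _ _ (fun k hk => hτ2 k (by omega))] at g2
    simp only [ff] at g2
    have hm := (RR_ok hN ha hb h4 hb0 _ (hτ2 _ hcon)).1
    have b1 := abs_le.1 (hL _ hm)
    have b2 := abs_le.1 (hL _ y0I)
    have b3 := (abs_lt.1 g2).1
    rw [hY0] at b3
    have : ((c₀ * N : ℕ) : ℝ) / N = c₀ := by push_cast; field_simp
    simp only [mul_zero, one_mul, this] at b3
    simp only [Nat.cast_zero, zero_div, zero_add, sub_zero] at b3
    linarith
  have hτ0 : τ ≠ 0 := fun h => hτ1 (by rw [h]; exact R0)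
  rw [GG_stop _ _ _ _ _ _ τ _ hτm _ hτ1, GG_run _ _ _ _ _ _ _ _ hτ2] at g1 g2
  obtain ⟨p, hp⟩ := Nat.exists_eq_succ_of_ne_zero hτ0
  have Rp := hτ2 p (by omega)
  have hcard : ((M.Y τ ω).card : ℝ) = (M.Y p ω).card +
      (chi (M.Y p ω) (M.mo p ω) - chi (M.Y p ω) (M.ka p ω)) := by
    rw [hp, Nat.succ_eq_add_one, Y_succ, card_new]
  have hle : (M.Y τ ω).card ≤ ⌊b * N⌋₊ := by
    have h1 : (M.Y p ω).card + 1 ≤ ⌊b * N⌋₊ := Rp.2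
    have h2 : ((M.Y τ ω).card : ℝ) ≤ ((M.Y p ω).card + 1 : ℕ) := by
      push_cast
      linarith [chi_bd (M.Y p ω) (M.mo p ω), chi_bd (M.Y p ω) (M.ka p ω)]
    exact (Nat.cast_le.1 h2).trans h1
  have hτI : ((M.Y τ ω).card : ℝ) / N ∈ Set.Icc (a / 4) b := by
    have := (RR_ok hN ha hb h4 hb0 _ Rp).2.2.2 (M.mo p ω) (M.ka p ω)
    rwa [← Y_succ, ← Nat.succ_eq_add_one, ← hp] at this
  have hτb : (M.Y τ ω).card = ⌊b * N⌋₊ := by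
    by_contra hne
    have hlt : (M.Y τ ω).card < ⌊b * N⌋₊ := lt_of_le_of_ne hle hne
    have hlow : ((M.Y τ ω).card : ℝ) < a / 2 * N := by
      by_contra h
      exact hτ1 ⟨not_lt.1 h, hlt⟩
    have hlow' : ((M.Y τ ω).card : ℝ) / N < a / 2 := by
      rw [div_lt_iff₀ hN']; exact hlow
    have l1 := LL_lt s _ _ hs (by linarith [hτI.1]) hlow' (by linarith)
    have l2 : LL s (3 * a / 4) ≤ LL s ((⌊a * N⌋₊ : ℝ) / N) := by
      rcases y0lo.eq_or_lt with h | h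
      · rw [h]
      · exact (LL_lt s _ _ hs (by linarith) h (by linarith)).le
    simp only [ff] at g2
    have b3 := (abs_lt.1 g2).1
    rw [hY0] at b3
    have : 0 ≤ (τ : ℝ) / N := by positivity
    simp only [mul_zero, one_mul, Nat.cast_zero, zero_div, zero_add, sub_zero] at b3
    linarith
  have hT := T_eq M ⌊b * N⌋₊ τ ω hτb (fun k hk => (hτ2 k hk).2.ne)
  have hU : M.UatT ⌊b * N⌋₊ ω = (∑ l, chi (M.Y τ ω) l * ww M τ ω l) / N := by
    unfold MoranModel.UatT
    rw [hT, if_pos (ENat.natCast_ne_top τ), ENat.toNat_natCast, U_eq]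
  rw [hU]
  have hu := sum_weight_bound hN (chi (M.Y τ ω)) (ww M τ ω) (chi_bd _) (ww_bd M τ ω)
  have hv := sum_weight_bound hN (fun l => 1 - chi (M.Y τ ω) l) (ww M τ ω) 
    (fun l => ⟨by linarith [(chi_bd (M.Y τ ω) l).2], by linarith [(chi_bd (M.Y τ ω) l).1]⟩)
    (ww_bd M τ ω)
  have hU0 : ∑ l, chi (M.Y 0 ω) l * ww M 0 ω l = ⌊a * N⌋₊ := by
    simp only [ww_zero]
    rw [← hY0, ← sum_chi]
    refine Finset.sum_congr rfl fun l _ => ?_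
    rcases chi_cases (M.Y 0 ω) l with h | h <;> rw [h] <;> norm_num
  have hV0 : ∑ l, (1 - chi (M.Y 0 ω) l) * ww M 0 ω l = 0 := by
    simp only [ww_zero]
    refine Finset.sum_eq_zero fun l _ => ?_
    rcases chi_cases (M.Y 0 ω) l with h | h <;> rw [h] <;> norm_num
  simp only [ff, hU0, hV0, hτb, hY0] at g1
  have hy0 : (0:ℝ) < (⌊a * N⌋₊ : ℝ) / N := by linarith [y0I.1]
  have ha0 : (⌊a * N⌋₊ : ℝ) / N * alf s a b ((⌊a * N⌋₊ : ℝ) / N) =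
      1 + KK s a b ((⌊a * N⌋₊ : ℝ) / N) := by
    unfold alf
    generalize (⌊a * N⌋₊ : ℝ) / N = x at hy0
    field_simp
  rw [ha0] at g1
  simp only [zero_div, zero_mul, add_zero, sub_zero] at g1
  generalize (∑ l, chi (M.Y τ ω) l * ww M τ ω l) / N = u at *
  generalize (∑ l, (1 - chi (M.Y τ ω) l) * ww M τ ω l) / N = v at *
  generalize alf s a b ((⌊b * N⌋₊ : ℝ) / N) = A at *
  generalize bet s a b ((⌊b * N⌋₊ : ℝ) / N) = B at *
  generalize KK s a b ((⌊a * N⌋₊ : ℝ) / N) = k0 at *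
  generalize KK s a b a = ka at *
  have key : |u / b - (1 + ka)| < ε := by
    have e : u / b - (1 + ka) = (u * A + v * B - (1 + k0)) + (k0 - ka) +
      (- (u * (A - 1 / b)) + - (v * B)) := by ring
    have b1 : |u * (A - 1 / b)| ≤ |A - 1 / b| := by
      rw [abs_mul]; exact mul_le_of_le_one_left (abs_nonneg _) hu
    have b2 : |v * B| ≤ |B| := by
      rw [abs_mul]; exact mul_le_of_le_one_left (abs_nonneg _) hv
    rw [e]
    refine (abs_add_le _ _).trans_lt ?_
    have c1 := abs_add_le (u * A + v * B - (1 + k0)) (k0 - ka)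
    have c2 := abs_add_le (- (u * (A - 1 / b))) (-(v * B))
    rw [abs_neg, abs_neg] at c2
    linarith
  have e : u - b * (1 + ka) = b * (u / b - (1 + ka)) := by field_simp
  rw [e, abs_mul, abs_of_pos hb0]
  exact lt_of_le_of_lt (mul_le_of_le_one_left (abs_nonneg _) hb.le) key

end

/-- Let `0 < a < b < 1`, and suppose that initially `Y₀ = ⌊aN⌋`.  Then
`(U_{T_{⌊bN⌋}}/N) 1_{T_{⌊bN⌋} < ∞}` converges in probability, as `N → ∞`, to
`b ⬝ a^{(1+s)/(2s)} (1−a)^{−1/(2s)} [(1−b)^{1/(2s)} b^{−(1+s)/(2s)} + ∫_a^b ⋯ dx]`.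
(The population size is written `N + 2` so that it ranges over the integers `≥ 2`.) -/
theorem moran_weight_at_hitting_time_tendsto
    (s a b : ℝ) (hs : 0 < s) (ha : 0 < a) (hab : a < b) (hb : b < 1)
    (Ω : ℕ → Type) [∀ N, MeasurableSpace (Ω N)]
    (M : ∀ N : ℕ, MoranModel (N + 2) s (Ω N))
    (hY0 : ∀ N ω, ((M N).Y 0 ω).card = ⌊a * ((N : ℝ) + 2)⌋₊) :
    ∀ ε : ℝ, 0 < ε →
      Tendsto (fun N : ℕ =>
          (M N).P {ω | ε ≤
            |(M N).UatT ⌊b * ((N : ℝ) + 2)⌋₊ ω -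
              b * (a ^ ((1 + s) / (2 * s)) / (1 - a) ^ (1 / (2 * s))) *
                ((1 - b) ^ (1 / (2 * s)) / b ^ ((1 + s) / (2 * s)) + intI s a b)|})
        atTop (nhds 0) := by
  intro ε hε
  have ha1 : a < 1 := hab.trans hb
  have hb0 : 0 < b := ha.trans hab
  obtain ⟨C, hC0, nal, nbe, nL, n0⟩ := all_nice s a b (a / 4) b hs ha ha1 (by linarith) hb
  obtain ⟨c₀, hc₀⟩ := exists_nat_ge (2 * C + 1)
  set ε₂ : ℝ := min 1 (LL s (3 * a / 4) - LL s (a / 2)) with hε₂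
  have hε₂0 : 0 < ε₂ := lt_min one_pos
    (by linarith [LL_lt s (a / 2) (3 * a / 4) hs (by linarith) (by linarith) (by linarith)])
  have hNat : Tendsto (fun N : ℕ => ((N + 2 : ℕ) : ℝ)) atTop atTop :=
    tendsto_natCast_atTop_atTop.comp (tendsto_add_atTop_nat 2)
  have ta : Tendsto (fun N : ℕ => (⌊a * ((N + 2 : ℕ) : ℝ)⌋₊ : ℝ) / ((N + 2 : ℕ) : ℝ)) atTop
      (nhds a) := (tendsto_nat_floor_mul_div_atTop ha.le).comp hNat
  have tb : Tendsto (fun N : ℕ => (⌊b * ((N + 2 : ℕ) : ℝ)⌋₊ : ℝ) / ((N + 2 : ℕ) : ℝ)) atTop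
      (nhds b) := (tendsto_nat_floor_mul_div_atTop hb0.le).comp hNat
  have hε4 : 0 < ε / 4 := by linarith
  have k1 := (Metric.tendsto_nhds.1
    ((KK_deriv s a b a hs ha ha1 ha ha1).continuousAt.tendsto.comp ta)) (ε / 4) hε4
  have k2 := (Metric.tendsto_nhds.1
    ((alf_deriv s a b b hs ha ha1 hb0 hb).continuousAt.tendsto.comp tb)) (ε / 4) hε4
  have k3 := (Metric.tendsto_nhds.1
    ((bet_deriv s a b b hs ha ha1 hb0 hb).continuousAt.tendsto.comp tb)) (ε / 4) hε4
  have h4 := (hNat.const_mul_atTop ha).eventually_ge_atTop 4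
  have hgap := (hNat.const_mul_atTop (by linarith : 0 < b - a)).eventually_ge_atTop 1
  set q1 : ℝ := c₀ * (2 * c₀ + 1) * (6 * C + |(0:ℝ)|) ^ 2 / (ε / 4) ^ 2
  set q2 : ℝ := c₀ * (2 * c₀ + 1) * (6 * C + |(1:ℝ)|) ^ 2 / ε₂ ^ 2
  have lim : Tendsto (fun N : ℕ => ENNReal.ofReal (q1 / ((N + 2 : ℕ) : ℝ)) +
      ENNReal.ofReal (q2 / ((N + 2 : ℕ) : ℝ))) atTop (nhds 0) := by
    have l1 : ∀ q : ℝ, Tendsto (fun N : ℕ => ENNReal.ofReal (q / ((N + 2 : ℕ) : ℝ))) atTop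
        (nhds 0) := fun q => by
      have := ENNReal.tendsto_ofReal (hNat.const_div_atTop q)
      rwa [ENNReal.ofReal_zero] at this
    simpa using (l1 q1).add (l1 q2)
  refine tendsto_of_tendsto_of_tendsto_of_le_of_le' tendsto_const_nhds lim
    (Eventually.of_forall fun _ => zero_le) ?_
  filter_upwards [k1, k2, k3, h4, hgap] with N k1 k2 k3 h4 hgap
  have hN : 0 < N + 2 := by omega
  simp only [Function.comp_apply, Real.dist_eq] at k1 k2 k3
  have hbb : bet s a b b = 0 := by simp [bet, KK_b]
  have hab' : alf s a b b = 1 / b := by simp [alf, KK_b]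
  rw [hbb, sub_zero] at k3
  rw [hab'] at k2
  have hR := RR_ok (N := N + 2) hN ha hb h4 hb0
  have c1 := GG_cheb (M N) _ hs hN hC0.le nal nbe n0 (cons1 s a b hs) hR c₀ (ε / 4) hε4
  have c2 := GG_cheb (M N) _ hs hN hC0.le n0 n0 nL (cons2 s hs) hR c₀ ε₂ hε₂0
  refine le_trans ?_ (add_le_add c1 c2)
  refine le_trans (measure_mono ?_) (measure_union_le _ _)
  intro ω hω
  by_contra hcon
  simp only [Set.mem_union, Set.mem_ofPred_eq, not_or, not_le] at hcon
  have hY0' : ((M N).Y 0 ω).card = ⌊a * ((N + 2 : ℕ) : ℝ)⌋₊ := by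
    rw [hY0 N ω]; push_cast; rfl
  have := good (M N) hN hs ha hab hb h4 hgap ω hY0' nL.1 c₀ hc₀ (min_le_left _ _)
    (min_le_right _ _) k1 k2 k3 hcon.1 hcon.2
  rw [KK_a s a b ha ha1] at this
  simp only [Set.mem_ofPred_eq] at hω
  push_cast at this
  linarith
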